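/- arXiv:2411.09074 — 4 statements merged into one kernel-verified Lean document; each statement's English description precedes it below -/
import Mathlib

section
/- Let D be an sDAG on a taxon set X in which the set of topologies is nonempty, and suppose that for every node t of D and every clade C of t with |C| ≥ 2, a nonnegative weight function p is assigned to the edges of D leaving t and partitioning C, with the weights of those edges summing to 1. Define the probability of a topology τ in D to be the product of p(e) over all edges e of τ. Then the resulting probabilities of the topologies in D are nonnegative and sum to 1, i.e., this assignment yields a probability distribution on the set of topologies represented in D. -/
namespace Phylo

variable {α : Type*} [DecidableEq α]

/-- A node of an sDAG: a finite set of clades (subsets of the taxon set).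
A proper subsplit is such a set with exactly two clades; the root node `{X}`
and the leaf nodes `{{x}}` have a single clade. -/
abbrev SNode (α : Type*) := Finset (Finset α)

/-- `∪(t)`: the union of the clades of a node. -/
def cladeUnion (t : SNode α) : Finset α := t.sup id

/-- A directed graph whose vertices are sDAG nodes, given by plain data. -/
structure Digraph (α : Type*) where
  nodes : Set (SNode α)
  edges : Set (SNode α × SNode α)

/-- A valid node on the taxon set `X`: its clades are nonempty pairwise disjoint
subsets of `X`, and it has either two clades (a proper subsplit) or one clade,
in which case it is the root `{X}` or a leaf `{{x}}`. -/
def IsValidNode (X : Finset α) (t : SNode α) : Prop :=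
  (∀ A ∈ t, A ⊆ X) ∧ (∀ A ∈ t, A.Nonempty) ∧
  (∀ A ∈ t, ∀ B ∈ t, A ≠ B → Disjoint A B) ∧
  (t.card = 1 ∨ t.card = 2) ∧
  (t.card = 1 → t = ({X} : SNode α) ∨ ∃ x, t = ({({x} : Finset α)} : SNode α))

/-- A leaf node `{{x}}`. -/
def IsLeafNode (t : SNode α) : Prop := ∃ x, t = ({({x} : Finset α)} : SNode α)

/-- `s` is a compatible child of `t`: `∪(s)` equals one of the clades of `t`
(the inequality `s ≠ t` only excludes the degenerate self-loops at single-clade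
nodes, where a node would trivially partition its own unique clade). -/
def CompatibleChild (t s : SNode α) : Prop := cladeUnion s ∈ t ∧ s ≠ t

/-- `D` is an sDAG on the taxon set `X`. -/
def IsSDag (X : Finset α) (D : Digraph α) : Prop :=
  ({X} : SNode α) ∈ D.nodes ∧
  (∀ x ∈ X, ({({x} : Finset α)} : SNode α) ∈ D.nodes) ∧
  (∀ t ∈ D.nodes, IsValidNode X t) ∧
  (∀ e ∈ D.edges, e.1 ∈ D.nodes ∧ e.2 ∈ D.nodes ∧ CompatibleChild e.1 e.2)

/-- `τ` is a subgraph of `D`. -/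
def Subgraph (τ D : Digraph α) : Prop := τ.nodes ⊆ D.nodes ∧ τ.edges ⊆ D.edges

/-- `τ` is (the sDAG representation of) a rooted bifurcating topology on `X`:
a tree-structured sDAG in which every non-leaf node has, for each of its clades,
exactly one outgoing edge to a node partitioning that clade, and every non-root
node has exactly one parent edge. -/
def IsTopology (X : Finset α) (τ : Digraph α) : Prop :=
  IsSDag X τ ∧
  (∀ t ∈ τ.nodes, ¬ IsLeafNode t →
    ∀ C ∈ t, ∃! s : SNode α, (t, s) ∈ τ.edges ∧ cladeUnion s = C) ∧
  (∀ s ∈ τ.nodes, s ≠ ({X} : SNode α) → ∃! t : SNode α, (t, s) ∈ τ.edges)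

/-- `τ` is a topology in the sDAG `D`. -/
def IsTopologyIn (X : Finset α) (D τ : Digraph α) : Prop :=
  IsTopology X τ ∧ Subgraph τ D

/-- `D` has edges between all compatible subsplits. -/
def AllCompatibleEdges (D : Digraph α) : Prop :=
  ∀ t ∈ D.nodes, ∀ s ∈ D.nodes, CompatibleChild t s → (t, s) ∈ D.edges

/-- The sDAG obtained from `D` by the NNI at the edge `{A ∪ B, C} → {A, B}`
swapping the clades `B` and `C`.  The new nodes are `t' = {A ∪ C, B}` and
`s' = {A, C}`, and the new edges are the central edge `t' → s'`, the edges
`u → t'` for every edge `u → t` of `D`, and the leafward edges from `s'`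
(resp. `t'`) to the children of the old nodes partitioning subsets of `A`, `C`
(resp. `B`). -/
def nniEnlarge (D : Digraph α) (A B C : Finset α) : Digraph α where
  nodes := D.nodes ∪ {({A ∪ C, B} : SNode α), ({A, C} : SNode α)}
  edges := D.edges ∪ {e : SNode α × SNode α |
      e = (({A ∪ C, B} : SNode α), ({A, C} : SNode α))
    ∨ (∃ u, (u, ({A ∪ B, C} : SNode α)) ∈ D.edges ∧ e = (u, ({A ∪ C, B} : SNode α)))
    ∨ (∃ u, (({A, B} : SNode α), u) ∈ D.edges ∧ cladeUnion u ⊆ A ∧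
        e = (({A, C} : SNode α), u))
    ∨ (∃ u, (({A, B} : SNode α), u) ∈ D.edges ∧ cladeUnion u ⊆ B ∧
        e = (({A ∪ C, B} : SNode α), u))
    ∨ (∃ u, (({A ∪ B, C} : SNode α), u) ∈ D.edges ∧ cladeUnion u ⊆ C ∧
        e = (({A, C} : SNode α), u)) }

/-- The NNI at the edge `{A ∪ B, C} → {A, B}` swapping `B` and `C` is applicable
to `D`: the clades are nonempty and pairwise disjoint and the edge is in `D`. -/
def NNIApplicable (D : Digraph α) (A B C : Finset α) : Prop :=
  A.Nonempty ∧ B.Nonempty ∧ C.Nonempty ∧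
  Disjoint A B ∧ Disjoint A C ∧ Disjoint B C ∧
  ((({A ∪ B, C} : SNode α)), (({A, B}) : SNode α)) ∈ D.edges

/-- The nearest-neighbor interchange on a topology `τ` at the edge
`{A ∪ B, C} → {A, B}`, swapping `B` and `C`: the nodes `{A ∪ B, C}` and `{A, B}`
and their incident edges are removed and replaced by `{A ∪ C, B}` and `{A, C}`,
rewiring the three subtrees on `A`, `B`, `C` accordingly and leaving the rest
of `τ` unchanged. -/
def nniSwapTop (τ : Digraph α) (A B C : Finset α) : Digraph α where
  nodes := (τ.nodes \ {({A ∪ B, C} : SNode α), ({A, B} : SNode α)}) ∪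
    {({A ∪ C, B} : SNode α), ({A, C} : SNode α)}
  edges := {e ∈ τ.edges | e.1 ≠ ({A ∪ B, C} : SNode α) ∧ e.1 ≠ ({A, B} : SNode α) ∧
      e.2 ≠ ({A ∪ B, C} : SNode α) ∧ e.2 ≠ ({A, B} : SNode α)} ∪
    {e : SNode α × SNode α |
      e = (({A ∪ C, B} : SNode α), ({A, C} : SNode α))
    ∨ (∃ u, (u, ({A ∪ B, C} : SNode α)) ∈ τ.edges ∧ e = (u, ({A ∪ C, B} : SNode α)))
    ∨ (∃ u, (({A, B} : SNode α), u) ∈ τ.edges ∧ cladeUnion u ⊆ A ∧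
        e = (({A, C} : SNode α), u))
    ∨ (∃ u, (({A, B} : SNode α), u) ∈ τ.edges ∧ cladeUnion u ⊆ B ∧
        e = (({A ∪ C, B} : SNode α), u))
    ∨ (∃ u, (({A ∪ B, C} : SNode α), u) ∈ τ.edges ∧ cladeUnion u ⊆ C ∧
        e = (({A, C} : SNode α), u)) }

/-- `τ'` is an NNI of the topology `τ`: `τ'` is obtained from `τ` by a
nearest-neighbor interchange at some edge `{A ∪ B, C} → {A, B}` of `τ`
(both NNIs at this edge are captured, by the symmetry of the data in `A`, `B`). -/
def IsNNIOf (τ' τ : Digraph α) : Prop :=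
  ∃ A B C : Finset α, A.Nonempty ∧ B.Nonempty ∧ C.Nonempty ∧
    Disjoint A B ∧ Disjoint A C ∧ Disjoint B C ∧
    (({A ∪ B, C} : SNode α), ({A, B} : SNode α)) ∈ τ.edges ∧
    τ' = nniSwapTop τ A B C

/-- Rooted binary trees with taxa at the leaves. -/
inductive BT (α : Type*) where
  | lf : α → BT α
  | nd : BT α → BT α → BT α

/-- The taxon set of a rooted binary tree. -/
def BT.taxa : BT α → Finset α
  | .lf x => {x}
  | .nd l r => l.taxa ∪ r.taxa

/-- The sDAG node (subsplit) associated to the root of a rooted binary tree. -/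
def BT.subsplit : BT α → SNode α
  | .lf x => ({({x} : Finset α)} : SNode α)
  | .nd l r => ({l.taxa, r.taxa} : SNode α)

/-- The subsplits occurring in a rooted binary tree. -/
def BT.sdagNodes : BT α → Set (SNode α)
  | .lf x => {({({x} : Finset α)} : SNode α)}
  | .nd l r => insert (({l.taxa, r.taxa} : SNode α)) (BT.sdagNodes l ∪ BT.sdagNodes r)

/-- The parent-child subsplit edges of a rooted binary tree. -/
def BT.sdagEdges : BT α → Set (SNode α × SNode α)
  | .lf _ => ∅
  | .nd l r =>
      insert ((({l.taxa, r.taxa} : SNode α), l.subsplit))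
        (insert ((({l.taxa, r.taxa} : SNode α), r.subsplit))
          (BT.sdagEdges l ∪ BT.sdagEdges r))

/-- The sDAG representation of a rooted binary tree, including the root node. -/
def BT.toDigraph (t : BT α) : Digraph α where
  nodes := insert ({t.taxa} : SNode α) t.sdagNodes
  edges := insert (({t.taxa} : SNode α), t.subsplit) t.sdagEdges

/-- The union of two digraphs (the sDAG generated by two sDAGs). -/
def Digraph.union (D E : Digraph α) : Digraph α := ⟨D.nodes ∪ E.nodes, D.edges ∪ E.edges⟩

end Phylo

namespace Phylo

open scoped BigOperators

/-- The probability of a topology `τ`: the product of the edge weights `p(e)` over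
the edges of `τ` (the edges carrying weights, i.e. those whose child partitions a
clade of size at least 2). -/
noncomputable def topProb {α : Type*} [DecidableEq α]
    (p : SNode α × SNode α → ℝ) (τ : Digraph α) : ℝ :=
  ∏ᶠ e ∈ {e ∈ τ.edges | 2 ≤ (cladeUnion e.2).card}, p e


section helpers

variable {α : Type*} [DecidableEq α]

theorem sub_cladeUnion {t : SNode α} {C : Finset α} (h : C ∈ t) : C ⊆ cladeUnion t :=
  Finset.le_sup (f := id) h

theorem mem_cladeUnion {t : SNode α} {x : α} : x ∈ cladeUnion t ↔ ∃ C ∈ t, x ∈ C := by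
  simp [cladeUnion, Finset.mem_sup]

theorem cladeUnion_singleton (C : Finset α) : cladeUnion ({C} : SNode α) = C := by
  simp [cladeUnion]

theorem cladeUnion_subset {X : Finset α} {t : SNode α} (h : IsValidNode X t) :
    cladeUnion t ⊆ X := by
  intro x hx
  obtain ⟨C, hC, hxC⟩ := mem_cladeUnion.1 hx
  exact h.1 C hC hxC

theorem eq_of_inter {X : Finset α} {t : SNode α} (h : IsValidNode X t) {A B : Finset α}
    (hA : A ∈ t) (hB : B ∈ t) {x : α} (hxA : x ∈ A) (hxB : x ∈ B) : A = B := by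
  by_contra hne
  exact Finset.disjoint_left.1 (h.2.2.1 A hA B hB hne) hxA hxB

theorem eq_singleton_of_mem {X : Finset α} {t : SNode α} (h : IsValidNode X t)
    (ht : cladeUnion t ∈ t) : t = {cladeUnion t} := by
  ext B
  rw [Finset.mem_singleton]
  constructor
  · intro hB
    obtain ⟨x, hx⟩ := h.2.1 B hB
    exact eq_of_inter h hB ht hx (sub_cladeUnion hB hx)
  · rintro rfl; exact ht

theorem root_or_leaf {X : Finset α} {t : SNode α} (h : IsValidNode X t)
    (ht : cladeUnion t ∈ t) : t = {X} ∨ IsLeafNode t := by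
  apply h.2.2.2.2
  rw [eq_singleton_of_mem h ht]; simp

theorem valid_nonempty {X : Finset α} {t : SNode α} (h : IsValidNode X t) : ∃ A, A ∈ t := by
  have : 0 < t.card := by have := h.2.2.2.1; omega
  exact Finset.card_pos.1 this

theorem eq_leaf_of_union {X : Finset α} {s : SNode α} (h : IsValidNode X s) {x : α}
    (hs : cladeUnion s = {x}) : s = {{x}} := by
  have key : ∀ A ∈ s, A = {x} := by
    intro A hA
    have h1 := sub_cladeUnion hA
    rw [hs] at h1
    exact (Finset.Nonempty.subset_singleton_iff (h.2.1 A hA)).1 h1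
  obtain ⟨A, hA⟩ := valid_nonempty h
  ext B
  rw [Finset.mem_singleton]
  refine ⟨key B, ?_⟩
  rintro rfl
  rw [← key A hA]; exact hA

theorem child_ne_root {X : Finset α} {t s : SNode α} (ht : IsValidNode X t)
    (h : CompatibleChild t s) : s ≠ {X} := by
  rintro rfl
  obtain ⟨h1, h2⟩ := h
  rw [cladeUnion_singleton] at h1
  have : cladeUnion t = X := (cladeUnion_subset ht).antisymm (sub_cladeUnion h1)
  apply h2
  have h3 := eq_singleton_of_mem ht (by rw [this]; exact h1)
  rw [h3, this]

theorem child_not_leaf {X : Finset α} {t s : SNode α} (hs : IsValidNode X s)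
    (h : CompatibleChild t s) : ¬ IsLeafNode t := by
  rintro ⟨x, rfl⟩
  obtain ⟨h1, h2⟩ := h
  rw [Finset.mem_singleton] at h1
  exact h2 (eq_leaf_of_union hs h1)

/-- Nodes reachable from the root under a choice function. -/
inductive Reach (X : Finset α) (g : SNode α → Finset α → SNode α) : SNode α → Prop
  | root : Reach X g {X}
  | step (t : SNode α) (C : Finset α) : Reach X g t → ¬ IsLeafNode t → C ∈ t →
      Reach X g (g t C)

/-- The topology generated by a choice function. -/
def gTop (X : Finset α) (g : SNode α → Finset α → SNode α) : Digraph α where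
  nodes := {t | Reach X g t}
  edges := {e | Reach X g e.1 ∧ ¬ IsLeafNode e.1 ∧ ∃ C ∈ e.1, e.2 = g e.1 C}

/-- A good choice function on a set of nodes. -/
def Good (X : Finset α) (N : Set (SNode α)) (g : SNode α → Finset α → SNode α) : Prop :=
  {X} ∈ N ∧ (∀ t ∈ N, IsValidNode X t) ∧
  ∀ t ∈ N, ¬ IsLeafNode t → ∀ C ∈ t, g t C ∈ N ∧ cladeUnion (g t C) = C ∧ g t C ≠ t

variable {X : Finset α} {N : Set (SNode α)} {g : SNode α → Finset α → SNode α}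

theorem Good.mem (h : Good X N g) {t : SNode α} (ht : Reach X g t) : t ∈ N := by
  induction ht with
  | root => exact h.1
  | step t C _ hl hC ih => exact (h.2.2 t ih hl C hC).1

theorem Good.valid (h : Good X N g) {t : SNode α} (ht : Reach X g t) : IsValidNode X t :=
  h.2.1 t (h.mem ht)

theorem Good.union (h : Good X N g) {t : SNode α} (ht : Reach X g t) (hl : ¬ IsLeafNode t)
    {C : Finset α} (hC : C ∈ t) : cladeUnion (g t C) = C :=
  (h.2.2 t (h.mem ht) hl C hC).2.1

theorem Good.compat (h : Good X N g) {t : SNode α} (ht : Reach X g t) (hl : ¬ IsLeafNode t)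
    {C : Finset α} (hC : C ∈ t) : CompatibleChild t (g t C) :=
  ⟨by rw [h.union ht hl hC]; exact hC, (h.2.2 t (h.mem ht) hl C hC).2.2⟩

/-- Laminarity of a pair of nodes. -/
def Lam (t u : SNode α) : Prop :=
  t = u ∨ Disjoint (cladeUnion t) (cladeUnion u) ∨ (∃ C ∈ u, cladeUnion t ⊆ C) ∨
    (∃ C ∈ t, cladeUnion u ⊆ C)

theorem sub_aux (h : Good X N g) {t v : SNode α} (ht : Reach X g t) (hv : Reach X g v)
    (htl : ¬ IsLeafNode t) {C : Finset α} (hCt : C ∈ t) (hCv : C ∈ v)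
    {C' : Finset α} (hC' : C' ∈ v) (hs : cladeUnion t ⊆ C') : t = v := by
  have vt := h.valid ht
  have vv := h.valid hv
  obtain ⟨x, hx⟩ := vt.2.1 C hCt
  have e : C = C' := eq_of_inter vv hCv hC' hx (hs (sub_cladeUnion hCt hx))
  subst e
  have e2 : cladeUnion t = C := hs.antisymm (sub_cladeUnion hCt)
  have e3 := root_or_leaf vt (by rw [e2]; exact hCt)
  have e4 : t = {X} := e3.resolve_right htl
  subst e4
  have e5 : C = X := by simpa using hCt
  subst e5
  have e6 : cladeUnion v = C := (cladeUnion_subset vv).antisymm (sub_cladeUnion hCv)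
  have e7 := eq_singleton_of_mem vv (by rw [e6]; exact hCv)
  rw [e7, e6]

theorem Lam.eq (h : Good X N g) {t v : SNode α} (hL : Lam t v)
    (ht : Reach X g t) (hv : Reach X g v)
    (htl : ¬ IsLeafNode t) (hvl : ¬ IsLeafNode v) {C : Finset α} (hCt : C ∈ t) (hCv : C ∈ v) :
    t = v := by
  rcases hL with hL | hL | ⟨C', hC', hs⟩ | ⟨C', hC', hs⟩
  · exact hL
  · obtain ⟨x, hx⟩ := (h.valid ht).2.1 C hCt
    exact absurd (sub_cladeUnion hCv hx) (Finset.disjoint_left.1 hL (sub_cladeUnion hCt hx))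
  · exact sub_aux h ht hv htl hCt hCv hC' hs
  · exact (sub_aux h hv ht hvl hCv hCt hC' hs).symm

theorem lam (h : Good X N g) {t u : SNode α} (ht : Reach X g t) (hu : Reach X g u) :
    Lam t u := by
  induction ht generalizing u with
  | root =>
    exact Or.inr (Or.inr (Or.inr ⟨X, by simp, cladeUnion_subset (h.valid hu)⟩))
  | step t C ht htl hC ih =>
    have hs := Reach.step t C ht htl hC
    have us := h.union ht htl hC
    induction hu with
    | root =>
      exact Or.inr (Or.inr (Or.inl ⟨X, by simp, cladeUnion_subset (h.valid hs)⟩))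
    | step v B hv hvl hB ihv =>
      have uu := h.union hv hvl hB
      have hsu := ih (Reach.step v B hv hvl hB)
      have htv := ih hv
      unfold Lam
      rw [us, uu]
      rcases ihv with e | hd | ⟨B', hB', hs'⟩ | ⟨C'', hC'', hs'⟩
      · right; right; right; exact ⟨B, by rw [e]; exact hB, subset_rfl⟩
      · rw [us] at hd
        right; left; exact hd.mono_right (sub_cladeUnion hB)
      · rw [us] at hs'
        by_cases hBB : B' = B
        · subst hBB
          rcases hsu with e | hd | ⟨C', hC', hs''⟩ | ⟨C', hC', hs''⟩
          · right; right; left; exact ⟨C, by rw [← e]; exact hC, subset_rfl⟩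
          · rw [uu] at hd
            right; left; exact hd.mono_left (sub_cladeUnion hC)
          · right; right; left; exact ⟨C', hC', (sub_cladeUnion hC).trans hs''⟩
          · rw [uu] at hs''
            by_cases hCC : C' = C
            · subst hCC
              have e : C' = B' := hs'.antisymm hs''
              subst e
              left
              rw [Lam.eq h htv ht hv htl hvl hC hB]
            · right; left
              exact ((h.valid ht).2.2.1 C' hC' C hC hCC).symm.mono_right hs''
        · right; left
          exact ((h.valid hv).2.2.1 B' hB' B hB hBB).mono_left hs'
      · right; right; right; exact ⟨C'', hC'', (sub_cladeUnion hB).trans hs'⟩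

theorem reach_leaf (h : Good X N g) (x : α) (n : ℕ) : ∀ (t : SNode α) (C : Finset α),
    C.card = n → Reach X g t → C ∈ t → x ∈ C → Reach X g {{x}} := by
  induction n using Nat.strong_induction_on with
  | _ n ih =>
    intro t C hn ht hC hx
    by_cases htl : IsLeafNode t
    · obtain ⟨y, rfl⟩ := htl
      rw [Finset.mem_singleton] at hC
      subst hC
      rw [Finset.mem_singleton] at hx
      subst hx
      exact ht
    · have hs := Reach.step t C ht htl hC
      have us := h.union ht htl hC
      have vs := h.valid hs
      obtain ⟨C', hC', hx'⟩ := mem_cladeUnion.1 (by rw [us]; exact hx : x ∈ cladeUnion (g t C))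
      have hsub : C' ⊆ C := by rw [← us]; exact sub_cladeUnion hC'
      by_cases e : C' = C
      · subst e
        rcases root_or_leaf vs (by rw [us]; exact hC') with e | ⟨y, e⟩
        · exact absurd e (child_ne_root (h.valid ht) (h.compat ht htl hC))
        · rw [e] at hC' hs
          rw [Finset.mem_singleton] at hC'
          subst hC'
          rw [Finset.mem_singleton] at hx
          subst hx
          exact hs
      · exact ih C'.card (by rw [← hn]; exact Finset.card_lt_card (hsub.ssubset_of_ne e))
          _ C' rfl hs hC' hx'

theorem gTop_isTopology (h : Good X N g) : IsTopology X (gTop X g) := by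
  refine ⟨⟨Reach.root, ?_, fun t ht => h.valid ht, ?_⟩, ?_, ?_⟩
  · intro x hx
    exact reach_leaf h x _ {X} X rfl Reach.root (by simp) hx
  · rintro ⟨t, s⟩ ⟨ht, hl, C, hC, hs⟩
    dsimp only at ht hl hC hs
    subst hs
    exact ⟨ht, Reach.step t C ht hl hC, h.compat ht hl hC⟩
  · intro t ht hl C hC
    refine ⟨g t C, ⟨⟨ht, hl, C, hC, rfl⟩, h.union ht hl hC⟩, ?_⟩
    rintro s ⟨⟨_, _, C', hC', hs⟩, hu⟩
    dsimp only at hC' hs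
    subst hs
    rw [h.union ht hl hC'] at hu
    rw [hu]
  · intro s hs hne
    rcases hs with _ | ⟨t, C, ht, hl, hC⟩
    · exact absurd rfl hne
    · refine ⟨t, ⟨ht, hl, C, hC, rfl⟩, ?_⟩
      rintro v ⟨hv, hvl, B, hB, e⟩
      dsimp only at hv hvl hB e
      have : C = B := by rw [← h.union ht hl hC, e, h.union hv hvl hB]
      subst this
      exact Lam.eq h (lam h hv ht) hv ht hvl hl hB hC

theorem topology_unique (h : Good X N g) {τ : Digraph α} (hτ : IsTopology X τ)
    (hag : ∀ t ∈ τ.nodes, ¬ IsLeafNode t → ∀ C ∈ t, (t, g t C) ∈ τ.edges)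
    (hun : ∀ t ∈ τ.nodes, ¬ IsLeafNode t → ∀ C ∈ t, cladeUnion (g t C) = C) :
    τ = gTop X g := by
  obtain ⟨⟨h1, h2, h3, h4⟩, h5, h6⟩ := hτ
  have hE : ∀ t s, (t, s) ∈ τ.edges → t ∈ τ.nodes ∧ s ∈ τ.nodes ∧ ¬ IsLeafNode t ∧
      cladeUnion s ∈ t ∧ s ≠ t ∧ s = g t (cladeUnion s) := by
    intro t s hts
    obtain ⟨a, b, c⟩ := h4 _ hts
    have hl := child_not_leaf (h3 _ b) c
    exact ⟨a, b, hl, c.1, c.2, (h5 t a hl _ c.1).unique ⟨hts, rfl⟩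
      ⟨hag t a hl _ c.1, hun t a hl _ c.1⟩⟩
  have hRN : ∀ t, Reach X g t → t ∈ τ.nodes := by
    intro t ht
    induction ht with
    | root => exact h1
    | step t C _ hl hC ih => exact (hE _ _ (hag t ih hl C hC)).2.1
  have hNR : ∀ n, ∀ s ∈ τ.nodes, X.card - (cladeUnion s).card = n → Reach X g s := by
    intro n
    induction n using Nat.strong_induction_on with
    | _ n ih =>
      intro s hs hn
      by_cases hsX : s = {X}
      · rw [hsX]; exact Reach.root
      · obtain ⟨t, hts, -⟩ := h6 s hs hsX
        obtain ⟨a, b, hl, c, hne, e⟩ := hE t s hts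
        have hRt : Reach X g t := by
          by_cases htX : t = {X}
          · rw [htX]; exact Reach.root
          · have hlt : (cladeUnion s).card < (cladeUnion t).card := by
              apply Finset.card_lt_card
              refine (sub_cladeUnion c).ssubset_of_ne ?_
              intro e'
              rcases root_or_leaf (h3 t a) (by rw [← e']; exact c) with e'' | e''
              · exact htX e''
              · exact hl e''
            have hle := Finset.card_le_card (cladeUnion_subset (h3 t a))
            exact ih _ (by omega) t a rfl
        rw [e]
        exact Reach.step t _ hRt hl c
  have en : τ.nodes = (gTop X g).nodes :=
    Set.ext fun t => ⟨fun ht => hNR _ t ht rfl, fun ht => hRN t ht⟩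
  have ee : τ.edges = (gTop X g).edges := by
    ext ⟨t, s⟩
    constructor
    · intro hts
      obtain ⟨a, b, hl, c, hne, e⟩ := hE t s hts
      exact ⟨hNR _ t a rfl, hl, _, c, e⟩
    · rintro ⟨ht, hl, C, hC, e⟩
      dsimp only at ht hl hC e
      rw [e]
      exact hag t (hRN t ht) hl C hC
  cases τ
  simp only at en ee
  rw [en, ee]

theorem finite_nodes {D : Digraph α} (hD : IsSDag X D) : D.nodes.Finite := by
  refine (X.powerset.powerset.finite_toSet).subset ?_
  intro t ht
  simp only [Finset.coe_powerset, Set.mem_preimage, Set.mem_powerset_iff]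
  intro A hA
  simpa using (hD.2.2.1 t ht).1 A hA

theorem finite_edges {D : Digraph α} (hD : IsSDag X D) : D.edges.Finite :=
  ((finite_nodes hD).prod (finite_nodes hD)).subset fun e he =>
    ⟨(hD.2.2.2 e he).1, (hD.2.2.2 e he).2.1⟩

theorem finite_tops {D : Digraph α} (hD : IsSDag X D) :
    {τ : Digraph α | IsTopologyIn X D τ}.Finite := by
  have hf : (D.nodes.powerset ×ˢ D.edges.powerset).Finite :=
    (finite_nodes hD).finite_subsets.prod (finite_edges hD).finite_subsets
  refine Set.Finite.of_finite_image (f := fun τ : Digraph α => (τ.nodes, τ.edges))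
    (hf.subset ?_) ?_
  · rintro _ ⟨τ, hτ, rfl⟩
    exact ⟨hτ.2.1, hτ.2.2⟩
  · rintro ⟨a, b⟩ _ ⟨c, d⟩ _ h
    simpa using h

/-- Index set: pairs (node, clade of size at least two). -/
abbrev Idx (D : Digraph α) :=
  {q : SNode α × Finset α // q.1 ∈ D.nodes ∧ q.2 ∈ q.1 ∧ 2 ≤ q.2.card}

theorem finite_idx {D : Digraph α} (hD : IsSDag X D) : Finite (Idx D) := by
  have : {q : SNode α × Finset α | q.1 ∈ D.nodes ∧ q.2 ∈ q.1 ∧ 2 ≤ q.2.card}.Finite := by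
    refine ((finite_nodes hD).prod X.powerset.finite_toSet).subset ?_
    rintro ⟨t, C⟩ ⟨h1, h2, -⟩
    exact ⟨h1, by simpa using (hD.2.2.1 t h1).1 C h2⟩
  exact this

open Classical in
/-- Extend a choice on big clades to all clades. -/
noncomputable def ext (D : Digraph α) (f : Idx D → SNode α) (t : SNode α) (C : Finset α) :
    SNode α :=
  if h : t ∈ D.nodes ∧ C ∈ t ∧ 2 ≤ C.card then f ⟨(t, C), h⟩ else {C}

theorem ext_big {D : Digraph α} (f : Idx D → SNode α) (i : Idx D) :
    ext D f i.1.1 i.1.2 = f i := by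
  unfold ext; rw [dif_pos i.2]

theorem ext_small {D : Digraph α} (f : Idx D → SNode α) (t : SNode α) (x : α) :
    ext D f t {x} = {{x}} := by
  unfold ext; rw [dif_neg]; simp

theorem small_or_big {D : Digraph α} (hD : IsSDag X D) {t : SNode α} (ht : t ∈ D.nodes)
    {C : Finset α} (hC : C ∈ t) : (∃ x, C = {x}) ∨ 2 ≤ C.card := by
  have := Finset.card_pos.2 ((hD.2.2.1 t ht).2.1 C hC)
  rcases Nat.lt_or_ge C.card 2 with h | h
  · left; exact Finset.card_eq_one.1 (by omega)
  · right; exact h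

/-- A topology contains the edges to singleton leaves. -/
theorem small_edge {τ : Digraph α} (hτ : IsTopology X τ) {t : SNode α}
    (ht : t ∈ τ.nodes) (hl : ¬ IsLeafNode t) {x : α} (hC : {x} ∈ t) :
    (t, ({{x}} : SNode α)) ∈ τ.edges := by
  obtain ⟨s, ⟨h1, h2⟩, -⟩ := hτ.2.1 t ht hl _ hC
  have := eq_leaf_of_union (hτ.1.2.2.1 s (hτ.1.2.2.2 _ h1).2.1) h2
  rwa [this] at h1

theorem ext_edge {D : Digraph α} (hD : IsSDag X D)
    (hnodecover : ∀ t ∈ D.nodes, ∃ τ : Digraph α, IsTopologyIn X D τ ∧ t ∈ τ.nodes)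
    (f : Idx D → SNode α)
    (hf : ∀ i, (i.1.1, f i) ∈ D.edges ∧ cladeUnion (f i) = i.1.2) :
    ∀ t ∈ D.nodes, ¬ IsLeafNode t → ∀ C ∈ t, (t, ext D f t C) ∈ D.edges ∧
      cladeUnion (ext D f t C) = C := by
  intro t ht hl C hC
  rcases small_or_big hD ht hC with ⟨x, rfl⟩ | hb
  · rw [ext_small]
    obtain ⟨τ, hτ, htτ⟩ := hnodecover t ht
    exact ⟨hτ.2.2 (small_edge hτ.1 htτ hl hC), cladeUnion_singleton _⟩
  · have := hf ⟨(t, C), ht, hC, hb⟩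
    rw [← ext_big f] at this
    exact this

theorem exists_unique_top {D : Digraph α} (hD : IsSDag X D)
    (hnodecover : ∀ t ∈ D.nodes, ∃ τ : Digraph α, IsTopologyIn X D τ ∧ t ∈ τ.nodes)
    (f : Idx D → SNode α)
    (hf : ∀ i, (i.1.1, f i) ∈ D.edges ∧ cladeUnion (f i) = i.1.2) :
    ∃! τ : {τ : Digraph α // IsTopologyIn X D τ},
      ∀ i : Idx D, i.1.1 ∈ τ.1.nodes → (i.1.1, f i) ∈ τ.1.edges := by
  have hE := ext_edge hD hnodecover f hf
  have hG : Good X D.nodes (ext D f) := by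
    refine ⟨hD.1, hD.2.2.1, fun t ht hl C hC => ?_⟩
    obtain ⟨h1, h2⟩ := hE t ht hl C hC
    have h3 := hD.2.2.2 _ h1
    exact ⟨h3.2.1, h2, h3.2.2.2⟩
  refine ⟨⟨gTop X (ext D f), gTop_isTopology hG, fun t ht => hG.mem ht, ?_⟩, ?_, ?_⟩
  · rintro ⟨t, s⟩ ⟨ht, hl, C, hC, e⟩
    dsimp only at ht hl hC e
    rw [e]
    exact (hE t (hG.mem ht) hl C hC).1
  · intro i hi
    refine ⟨hi, ?_, i.1.2, i.2.2.1, (ext_big f i).symm⟩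
    have := hf i
    have h3 := hD.2.2.2 _ this.1
    exact child_not_leaf (hD.2.2.1 _ h3.2.1) h3.2.2
  · rintro ⟨τ, hτ⟩ hag
    dsimp only at hag
    apply Subtype.ext
    refine topology_unique hG hτ.1 ?_ ?_
    · intro t ht hl C hC
      rcases small_or_big hD (hτ.2.1 ht) hC with ⟨x, rfl⟩ | hb
      · rw [ext_small]; exact small_edge hτ.1 ht hl hC
      · have := hag ⟨(t, C), hτ.2.1 ht, hC, hb⟩ ht
        rw [← ext_big f] at this
        exact this
    · intro t ht hl C hC
      exact (hE t (hτ.2.1 ht) hl C hC).2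

theorem big_not_leaf {t : SNode α} {C : Finset α} (hC : C ∈ t) (hb : 2 ≤ C.card) :
    ¬ IsLeafNode t := by
  rintro ⟨x, rfl⟩
  rw [Finset.mem_singleton] at hC
  subst hC
  simp at hb

open Classical in
theorem topProb_eq {D : Digraph α} (hD : IsSDag X D) [Fintype (Idx D)]
    (p : SNode α × SNode α → ℝ) (S : Idx D → Finset (SNode α))
    (hS : ∀ i s, s ∈ S i ↔ (i.1.1, s) ∈ D.edges ∧ cladeUnion s = i.1.2)
    (hsum : ∀ i, ∑ s ∈ S i, p (i.1.1, s) = 1)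
    {τ : Digraph α} (hτ : IsTopologyIn X D τ) :
    topProb p τ = ∏ i : Idx D,
      ∑ s ∈ (S i).filter (fun s => i.1.1 ∈ τ.nodes → (i.1.1, s) ∈ τ.edges), p (i.1.1, s) := by
  have hfin : {e ∈ τ.edges | 2 ≤ (cladeUnion e.2).card}.Finite :=
    (finite_edges hτ.1.1).subset fun e he => he.1
  rw [topProb, finprod_mem_eq_finite_toFinset_prod _ hfin]
  have hsplit : ∏ i : Idx D,
      ∑ s ∈ (S i).filter (fun s => i.1.1 ∈ τ.nodes → (i.1.1, s) ∈ τ.edges), p (i.1.1, s)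
      = ∏ i ∈ Finset.univ.filter (fun i : Idx D => i.1.1 ∈ τ.nodes),
      ∑ s ∈ (S i).filter (fun s => i.1.1 ∈ τ.nodes → (i.1.1, s) ∈ τ.edges), p (i.1.1, s) := by
    symm
    apply Finset.prod_subset (Finset.filter_subset _ _)
    intro i _ hi
    have hi' : i.1.1 ∉ τ.nodes := by simpa using hi
    rw [Finset.filter_true_of_mem (fun s _ h => absurd h hi')]
    exact hsum i
  rw [hsplit]
  have hE : ∀ e ∈ hfin.toFinset, e ∈ τ.edges ∧ e.1 ∈ τ.nodes ∧ cladeUnion e.2 ∈ e.1 ∧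
      2 ≤ (cladeUnion e.2).card := by
    intro e he
    rw [Set.Finite.mem_toFinset] at he
    have := hτ.1.1.2.2.2 e he.1
    exact ⟨he.1, this.1, this.2.2.1, he.2⟩
  have huniq : ∀ t s s', (t, s) ∈ τ.edges → (t, s') ∈ τ.edges → cladeUnion s = cladeUnion s' →
      2 ≤ (cladeUnion s).card → s = s' := by
    intro t s s' h1 h2 he hb
    have := hτ.1.1.2.2.2 _ h1
    exact (hτ.1.2.1 t this.1 (big_not_leaf this.2.2.1 hb) _ this.2.2.1).unique
      ⟨h1, rfl⟩ ⟨h2, he.symm⟩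
  refine Finset.prod_bij (fun e he => (⟨(e.1, cladeUnion e.2), hτ.2.1 (hE e he).2.1,
    (hE e he).2.2.1, (hE e he).2.2.2⟩ : Idx D)) ?_ ?_ ?_ ?_
  · intro e he
    simpa using (hE e he).2.1
  · rintro ⟨t, s⟩ he ⟨t', s'⟩ he' heq
    simp only [Subtype.mk.injEq, Prod.mk.injEq] at heq
    obtain ⟨rfl, h2⟩ := heq
    rw [huniq t s s' (hE _ he).1 (hE _ he').1 h2 (hE _ he).2.2.2]
  · rintro ⟨⟨t, C⟩, h1, h2, h3⟩ hi
    have ht : t ∈ τ.nodes := by simpa using hi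
    obtain ⟨s, ⟨hs, hu⟩, -⟩ := hτ.1.2.1 t ht (big_not_leaf h2 h3) C h2
    refine ⟨(t, s), ?_, ?_⟩
    · rw [Set.Finite.mem_toFinset]
      exact ⟨hs, by rw [hu]; exact h3⟩
    · simp [hu]
  · rintro ⟨t, s⟩ he
    obtain ⟨a, b, c, d⟩ := hE _ he
    dsimp only at b c d
    symm
    convert Finset.sum_singleton (fun s => p (t, s)) s using 2
    ext s'
    simp only [Finset.mem_filter, Finset.mem_singleton, hS]
    constructor
    · rintro ⟨⟨h1, h2⟩, h3⟩
      exact (huniq t s s' a (h3 b) h2.symm d).symm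
    · rintro rfl
      exact ⟨⟨hτ.2.2 a, rfl⟩, fun _ => a⟩

end helpers

/-- Let `D` be an sDAG whose set of topologies is nonempty, in which
every node and every edge lies on at least one topology and every clade of size at
least 2 of every node has at least one outgoing edge partitioning it.  Suppose that
for every node `t` and every clade `C` of `t` with `|C| ≥ 2` nonnegative weights
are assigned to the edges of `D` leaving `t` and partitioning `C`, summing to 1.
Then the induced probabilities of the topologies in `D` are nonnegative and sum
to 1, i.e. they form a probability distribution on the topologies of `D`. -/
theorem statement_13 {α : Type*} [DecidableEq α] (X : Finset α) (D : Digraph α)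
    (hD : IsSDag X D)
    (hne : ∃ τ : Digraph α, IsTopologyIn X D τ)
    (hnodecover : ∀ t ∈ D.nodes, ∃ τ : Digraph α, IsTopologyIn X D τ ∧ t ∈ τ.nodes)
    (hedgecover : ∀ e ∈ D.edges, ∃ τ : Digraph α, IsTopologyIn X D τ ∧ e ∈ τ.edges)
    (hout : ∀ t ∈ D.nodes, ∀ C ∈ t, 2 ≤ C.card →
      ∃ s : SNode α, (t, s) ∈ D.edges ∧ cladeUnion s = C)
    (p : SNode α × SNode α → ℝ)
    (hp0 : ∀ e ∈ D.edges, 0 ≤ p e)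
    (hpsum : ∀ t ∈ D.nodes, ∀ C ∈ t, 2 ≤ C.card →
      ∑ᶠ s ∈ {s : SNode α | (t, s) ∈ D.edges ∧ cladeUnion s = C}, p (t, s) = 1) :
    (∀ τ : Digraph α, IsTopologyIn X D τ → 0 ≤ topProb p τ) ∧
      ∑' τ : {τ : Digraph α // IsTopologyIn X D τ}, topProb p τ.1 = 1 := by
  classical
  refine ⟨fun τ hτ => ?_, ?_⟩
  · rw [topProb]
    exact finprod_mem_induction (fun x : ℝ => 0 ≤ x) zero_le_one
      (fun _ _ h1 h2 => mul_nonneg h1 h2) (fun e he => hp0 e (hτ.2.2 he.1))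
  · haveI := finite_idx hD
    haveI : Fintype (Idx D) := Fintype.ofFinite _
    haveI : Finite {τ : Digraph α // IsTopologyIn X D τ} := finite_tops hD
    haveI : Fintype {τ : Digraph α // IsTopologyIn X D τ} := Fintype.ofFinite _
    have hSf : ∀ i : Idx D,
        {s : SNode α | (i.1.1, s) ∈ D.edges ∧ cladeUnion s = i.1.2}.Finite := fun i =>
      (finite_nodes hD).subset fun s hs => (hD.2.2.2 _ hs.1).2.1
    let S : Idx D → Finset (SNode α) := fun i => (hSf i).toFinset
    have hS : ∀ i s, s ∈ S i ↔ (i.1.1, s) ∈ D.edges ∧ cladeUnion s = i.1.2 := by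
      intro i s
      simp [S]
    have hsum : ∀ i, ∑ s ∈ S i, p (i.1.1, s) = 1 := by
      intro i
      rw [← hpsum i.1.1 i.2.1 i.1.2 i.2.2.1 i.2.2.2,
        finsum_mem_eq_finite_toFinset_sum _ (hSf i)]
    rw [tsum_fintype]
    have h1 : ∀ τ : {τ : Digraph α // IsTopologyIn X D τ}, topProb p τ.1 =
        ∑ f ∈ Fintype.piFinset S,
          if (∀ i : Idx D, i.1.1 ∈ τ.1.nodes → (i.1.1, f i) ∈ τ.1.edges) then
            ∏ i, p (i.1.1, f i) else 0 := by
      intro τ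
      rw [topProb_eq hD p S hS hsum τ.2, Finset.prod_univ_sum, ← Finset.sum_filter]
      refine Finset.sum_congr ?_ fun _ _ => rfl
      ext f
      simp only [Fintype.mem_piFinset, Finset.mem_filter]
      exact forall_and
    rw [Finset.sum_congr rfl fun τ _ => h1 τ, Finset.sum_comm]
    have h2 : ∀ f ∈ Fintype.piFinset S,
        (∑ τ : {τ : Digraph α // IsTopologyIn X D τ},
          if (∀ i : Idx D, i.1.1 ∈ τ.1.nodes → (i.1.1, f i) ∈ τ.1.edges) then
            ∏ i, p (i.1.1, f i) else 0) = ∏ i, p (i.1.1, f i) := by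
      intro f hf
      rw [Fintype.mem_piFinset] at hf
      obtain ⟨τ, hτ, hu⟩ := exists_unique_top hD hnodecover f fun i => (hS i _).1 (hf i)
      rw [Fintype.sum_eq_single τ, if_pos hτ]
      intro τ' hne'
      rw [if_neg fun h => hne' (hu τ' h)]
    rw [Finset.sum_congr rfl h2, ← Finset.prod_univ_sum S fun i s => p (i.1.1, s)]
    exact Finset.prod_eq_one fun i _ => hsum i

end Phylo
end

section
/- There exist two distinct rooted bifurcating topologies τ₁ and τ₂ on a taxon set X such that the sDAG generated by τ₁ and τ₂ contains a topology distinct from both τ₁ and τ₂. In particular, for X = {0,1,...,6}, τ₁ = (0,(1,(2,(3,(4,(5,6)))))) and τ₂ = ((0,1),(2,(3,(5,(4,6))))), the sDAG generated by τ₁ and τ₂ contains the topology with root split {0}|{1,2,3,4,5,6} and subsplit {4,6}|{5}, namely (0,(1,(2,(3,(5,(4,6)))))), which equals neither τ₁ nor τ₂. -/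
namespace Phylo

/-- τ₁ = (0,(1,(2,(3,(4,(5,6)))))) -/
def sig1 : BT ℕ :=
  .nd (.lf 0) (.nd (.lf 1) (.nd (.lf 2) (.nd (.lf 3) (.nd (.lf 4) (.nd (.lf 5) (.lf 6))))))

/-- τ₂ = ((0,1),(2,(3,(5,(4,6))))) -/
def sig2 : BT ℕ :=
  .nd (.nd (.lf 0) (.lf 1)) (.nd (.lf 2) (.nd (.lf 3) (.nd (.lf 5) (.nd (.lf 4) (.lf 6)))))

/-- τ₃ = (0,(1,(2,(3,(5,(4,6)))))): the additional topology, with root split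
{0}|{1,2,3,4,5,6} and subsplit {4,6}|{5}. -/
def sig3 : BT ℕ :=
  .nd (.lf 0) (.nd (.lf 1) (.nd (.lf 2) (.nd (.lf 3) (.nd (.lf 5) (.nd (.lf 4) (.lf 6))))))

/-- Finset version of `BT.sdagNodes`. -/
def BT.nodesF : BT ℕ → Finset (SNode ℕ)
  | .lf x => {({({x} : Finset ℕ)} : SNode ℕ)}
  | .nd l r => insert (({l.taxa, r.taxa} : SNode ℕ)) (BT.nodesF l ∪ BT.nodesF r)

/-- Finset version of `BT.sdagEdges`. -/
def BT.edgesF : BT ℕ → Finset (SNode ℕ × SNode ℕ)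
  | .lf _ => ∅
  | .nd l r =>
      insert ((({l.taxa, r.taxa} : SNode ℕ), l.subsplit))
        (insert ((({l.taxa, r.taxa} : SNode ℕ), r.subsplit))
          (BT.edgesF l ∪ BT.edgesF r))

/-- All nodes of the digraph of a tree. -/
def BT.allNodesF (t : BT ℕ) : Finset (SNode ℕ) := insert ({t.taxa} : SNode ℕ) t.nodesF

/-- All edges of the digraph of a tree. -/
def BT.allEdgesF (t : BT ℕ) : Finset (SNode ℕ × SNode ℕ) :=
  insert (({t.taxa} : SNode ℕ), t.subsplit) t.edgesF

lemma BT.coe_nodesF (t : BT ℕ) : (t.nodesF : Set (SNode ℕ)) = t.sdagNodes := by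
  induction t with
  | lf x => simp [BT.nodesF, BT.sdagNodes]
  | nd l r hl hr => simp [BT.nodesF, BT.sdagNodes, hl, hr]

lemma BT.coe_edgesF (t : BT ℕ) : (t.edgesF : Set (SNode ℕ × SNode ℕ)) = t.sdagEdges := by
  induction t with
  | lf x => simp [BT.edgesF, BT.sdagEdges]
  | nd l r hl hr => simp [BT.edgesF, BT.sdagEdges, hl, hr]

lemma BT.mem_nodes (t : BT ℕ) (s : SNode ℕ) : s ∈ t.toDigraph.nodes ↔ s ∈ t.allNodesF := by
  simp [BT.toDigraph, BT.allNodesF, ← BT.coe_nodesF]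

lemma BT.mem_edges (t : BT ℕ) (e : SNode ℕ × SNode ℕ) :
    e ∈ t.toDigraph.edges ↔ e ∈ t.allEdgesF := by
  simp [BT.toDigraph, BT.allEdgesF, ← BT.coe_edgesF]

/-- Decidable criterion for a valid node. -/
def ValidF (X : Finset ℕ) (t : SNode ℕ) : Prop :=
  (∀ A ∈ t, A ⊆ X) ∧ (∀ A ∈ t, A ≠ ∅) ∧
  (∀ A ∈ t, ∀ B ∈ t, A ≠ B → A ∩ B = ∅) ∧
  (t.card = 1 ∨ t.card = 2) ∧
  (t.card = 1 → t = ({X} : SNode ℕ) ∨ ∃ x ∈ X, t = ({({x} : Finset ℕ)} : SNode ℕ))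

instance (X : Finset ℕ) (t : SNode ℕ) : Decidable (ValidF X t) := by
  unfold ValidF; infer_instance

instance (t s : SNode ℕ) : Decidable (CompatibleChild t s) := by
  unfold CompatibleChild; infer_instance

lemma ValidF.isValid {X : Finset ℕ} {t : SNode ℕ} (h : ValidF X t) : IsValidNode X t := by
  obtain ⟨h1, h2, h3, h4, h5⟩ := h
  refine ⟨h1, fun A hA => Finset.nonempty_iff_ne_empty.2 (h2 A hA),
    fun A hA B hB hAB => Finset.disjoint_iff_inter_eq_empty.2 (h3 A hA B hB hAB), h4, fun hc => ?_⟩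
  rcases h5 hc with h | ⟨x, -, h⟩
  · exact Or.inl h
  · exact Or.inr ⟨x, h⟩

lemma isTopology_of {X : Finset ℕ} {t : BT ℕ}
    (h1 : ({X} : SNode ℕ) ∈ t.allNodesF)
    (h2 : ∀ x ∈ X, ({({x} : Finset ℕ)} : SNode ℕ) ∈ t.allNodesF)
    (h3 : ∀ s ∈ t.allNodesF, ValidF X s)
    (h4 : ∀ e ∈ t.allEdgesF, e.1 ∈ t.allNodesF ∧ e.2 ∈ t.allNodesF ∧ CompatibleChild e.1 e.2)
    (h5 : ∀ s ∈ t.allNodesF, (∃ x ∈ X, s = ({({x} : Finset ℕ)} : SNode ℕ)) ∨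
      ∀ C ∈ s, ∃ e ∈ t.allEdgesF, (e.1 = s ∧ cladeUnion e.2 = C) ∧
        ∀ f ∈ t.allEdgesF, f.1 = s → cladeUnion f.2 = C → f.2 = e.2)
    (h6 : ∀ s ∈ t.allNodesF, s = ({X} : SNode ℕ) ∨
      ∃ e ∈ t.allEdgesF, e.2 = s ∧ ∀ f ∈ t.allEdgesF, f.2 = s → f.1 = e.1) :
    IsTopology X t.toDigraph := by
  refine ⟨⟨(t.mem_nodes _).2 h1, fun x hx => (t.mem_nodes _).2 (h2 x hx),
    fun s hs => (h3 s ((t.mem_nodes _).1 hs)).isValid, fun e he => ?_⟩, ?_, ?_⟩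
  · simp only [t.mem_nodes]
    exact h4 e ((t.mem_edges _).1 he)
  · intro s hs hl C hC
    simp only [t.mem_edges]
    rcases h5 s ((t.mem_nodes _).1 hs) with ⟨x, -, h⟩ | h
    · exact absurd ⟨x, h⟩ hl
    · obtain ⟨⟨a, b⟩, he, ⟨rfl, hb⟩, hu⟩ := h C hC
      exact ⟨b, ⟨he, hb⟩, fun y hy => hu (_, y) hy.1 rfl hy.2⟩
  · intro s hs hl
    simp only [t.mem_edges]
    rcases h6 s ((t.mem_nodes _).1 hs) with h | ⟨⟨a, b⟩, he, rfl, hu⟩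
    · exact absurd h hl
    · exact ⟨a, he, fun y hy => hu (y, _) hy rfl⟩

lemma top1 : IsTopology (Finset.range 7) sig1.toDigraph := by
  apply isTopology_of <;> decide +kernel

lemma top2 : IsTopology (Finset.range 7) sig2.toDigraph := by
  apply isTopology_of <;> decide +kernel

lemma top3 : IsTopology (Finset.range 7) sig3.toDigraph := by
  apply isTopology_of <;> decide +kernel

lemma toDigraph_ne {t u : BT ℕ} (s : SNode ℕ) (h1 : s ∈ t.allNodesF) (h2 : s ∉ u.allNodesF) :
    t.toDigraph ≠ u.toDigraph := by
  intro h
  rw [← BT.mem_nodes] at h1 h2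
  rw [h] at h1
  exact h2 h1

lemma ne12 : sig1.toDigraph ≠ sig2.toDigraph :=
  toDigraph_ne ({{5}, {6}} : SNode ℕ) (by decide +kernel) (by decide +kernel)

lemma ne31 : sig3.toDigraph ≠ sig1.toDigraph :=
  toDigraph_ne ({{4}, {6}} : SNode ℕ) (by decide +kernel) (by decide +kernel)

lemma ne32 : sig3.toDigraph ≠ sig2.toDigraph :=
  toDigraph_ne ({{0}, {1, 2, 3, 4, 5, 6}} : SNode ℕ) (by decide +kernel) (by decide +kernel)

lemma sub3 : Subgraph sig3.toDigraph (Digraph.union sig1.toDigraph sig2.toDigraph) := by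
  constructor
  · have h : ∀ s ∈ sig3.allNodesF, s ∈ sig1.allNodesF ∨ s ∈ sig2.allNodesF := by decide +kernel
    intro s hs
    simp only [← BT.mem_nodes] at h
    exact h s hs
  · have h : ∀ s ∈ sig3.allEdgesF, s ∈ sig1.allEdgesF ∨ s ∈ sig2.allEdgesF := by decide +kernel
    intro s hs
    simp only [← BT.mem_edges] at h
    exact h s hs

/-- There exist two distinct rooted bifurcating topologies whose
generated sDAG contains a topology distinct from both; in particular this holds
for τ₁ = (0,(1,(2,(3,(4,(5,6)))))) and τ₂ = ((0,1),(2,(3,(5,(4,6))))) on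
X = {0,…,6}, whose sDAG contains τ₃ = (0,(1,(2,(3,(5,(4,6)))))). -/
theorem statement_14 :
    (∃ (X : Finset ℕ) (σ1 σ2 σ3 : Digraph ℕ),
        IsTopology X σ1 ∧ IsTopology X σ2 ∧ σ1 ≠ σ2 ∧
        IsTopologyIn X (Digraph.union σ1 σ2) σ3 ∧ σ3 ≠ σ1 ∧ σ3 ≠ σ2) ∧
      BT.toDigraph sig1 ≠ BT.toDigraph sig2 ∧
      IsTopologyIn (Finset.range 7)
        (Digraph.union (BT.toDigraph sig1) (BT.toDigraph sig2)) (BT.toDigraph sig3) ∧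
      BT.toDigraph sig3 ≠ BT.toDigraph sig1 ∧
      BT.toDigraph sig3 ≠ BT.toDigraph sig2 := by
  exact ⟨⟨Finset.range 7, _, _, _, top1, top2, ne12, ⟨top3, sub3⟩, ne31, ne32⟩,
    ne12, ⟨top3, sub3⟩, ne31, ne32⟩

end Phylo
end

section
/- There exists an sDAG D on a taxon set X having all compatible edges, and an NNI applied to D producing the sDAG D' with central edge t' → s', such that D' does not have all compatible edges; in particular, D' can lack an edge from t' to a compatible child subsplit present as a node of D', or lack an edge from a compatible parent subsplit present as a node of D' to s'. -/
namespace Phylo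

/-- The nodes of the example: the subsplits of the two topologies
`((((0,4),1),2),3)` and `((0,(2,4)),(1,3))`. -/
def exNodes : Finset (SNode ℕ) :=
  { {{0, 1, 2, 3, 4}}, {{0}}, {{1}}, {{2}}, {{3}}, {{4}},
    {{0, 1, 2, 4}, {3}}, {{0, 1, 4}, {2}}, {{0, 4}, {1}}, {{0}, {4}},
    {{0, 2, 4}, {1, 3}}, {{0}, {2, 4}}, {{2}, {4}}, {{1}, {3}} }

/-- The example sDAG: all compatible edges between the example nodes. -/
def exDag : Digraph ℕ where
  nodes := {t | t ∈ exNodes}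
  edges := {e | e.1 ∈ exNodes ∧ e.2 ∈ exNodes ∧ CompatibleChild e.1 e.2}

theorem exDag_valid (t : SNode ℕ) (ht : t ∈ exNodes) :
    IsValidNode {0, 1, 2, 3, 4} t := by
  have key : ∀ t ∈ exNodes, (∀ A ∈ t, A ⊆ ({0, 1, 2, 3, 4} : Finset ℕ)) ∧
      (∀ A ∈ t, A.Nonempty) ∧
      (∀ A ∈ t, ∀ B ∈ t, A ≠ B → Disjoint A B) ∧
      (t.card = 1 ∨ t.card = 2) ∧
      (t.card = 1 → t = {{0, 1, 2, 3, 4}} ∨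
        ∃ x ∈ Finset.range 5, t = ({({x} : Finset ℕ)} : SNode ℕ)) := by
    decide +kernel
  obtain ⟨h1, h2, h3, h4, h5⟩ := key t ht
  exact ⟨h1, h2, h3, h4, fun h => (h5 h).imp id fun ⟨x, _, hx⟩ => ⟨x, hx⟩⟩

/-- After the NNI, `t' = {024, 1}` is not joined to its compatible child `{0, 24}`. -/
theorem exDag_missing :
    (({{0, 4} ∪ {2}, {1}} : SNode ℕ), ({{0}, {2, 4}} : SNode ℕ)) ∉
      (nniEnlarge exDag {0, 4} {1} {2}).edges := by
  have h1 : ({{0, 4} ∪ {2}, {1}} : SNode ℕ) ∉ exNodes := by decide +kernel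
  rintro (h | h | ⟨u, -, h⟩ | ⟨u, -, -, h⟩ | ⟨u, -, hu, h⟩ | ⟨u, -, -, h⟩)
  · exact h1 h.1
  · exact absurd (congrArg Prod.snd h) (by dsimp only; decide +kernel)
  · exact absurd (congrArg Prod.snd h) (by dsimp only; decide +kernel)
  · exact absurd (congrArg Prod.fst h) (by dsimp only; decide +kernel)
  · have h2 : ({{0}, {2, 4}} : SNode ℕ) = u := congrArg Prod.snd h
    subst h2
    exact absurd hu (by unfold cladeUnion; decide +kernel)
  · exact absurd (congrArg Prod.fst h) (by dsimp only; decide +kernel)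

/-- There exist an sDAG `D` on a taxon set `X` having all compatible
edges and an applicable NNI (at the edge `{A ∪ B, C} → {A, B}`, swapping `B` and
`C`, with central edge `t' → s' = ({A ∪ C, B}, {A, C})`) such that the post-NNI
sDAG does not have all compatible edges; in particular it can lack an edge from
`t'` to a compatible child subsplit present as a node, or an edge from a compatible
parent subsplit present as a node to `s'`. -/
theorem statement_15 :
    ∃ (X : Finset ℕ) (D : Digraph ℕ) (A B C : Finset ℕ),
      IsSDag X D ∧ AllCompatibleEdges D ∧ NNIApplicable D A B C ∧
      ¬ AllCompatibleEdges (nniEnlarge D A B C) ∧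
      ((∃ u ∈ (nniEnlarge D A B C).nodes,
          CompatibleChild ({A ∪ C, B} : SNode ℕ) u ∧
          (({A ∪ C, B} : SNode ℕ), u) ∉ (nniEnlarge D A B C).edges) ∨
        (∃ u ∈ (nniEnlarge D A B C).nodes,
          CompatibleChild u ({A, C} : SNode ℕ) ∧
          (u, ({A, C} : SNode ℕ)) ∉ (nniEnlarge D A B C).edges)) := by
  have hn : ({{0}, {2, 4}} : SNode ℕ) ∈ (nniEnlarge exDag {0, 4} {1} {2}).nodes :=
    Or.inl (show _ ∈ exNodes by decide +kernel)
  have ht : ({{0, 4} ∪ {2}, {1}} : SNode ℕ) ∈ (nniEnlarge exDag {0, 4} {1} {2}).nodes :=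
    Or.inr (Or.inl rfl)
  have hc : CompatibleChild ({{0, 4} ∪ {2}, {1}} : SNode ℕ) {{0}, {2, 4}} := by
    unfold CompatibleChild cladeUnion
    decide +kernel
  refine ⟨{0, 1, 2, 3, 4}, exDag, {0, 4}, {1}, {2}, ⟨?_, ?_, exDag_valid, fun e he => he⟩,
    fun t ht s hs h => ⟨ht, hs, h⟩, ?_, fun h => exDag_missing (h _ ht _ hn hc),
    Or.inl ⟨_, hn, hc, exDag_missing⟩⟩
  · show _ ∈ exNodes
    decide +kernel
  · show ∀ x ∈ ({0, 1, 2, 3, 4} : Finset ℕ), ({({x} : Finset ℕ)} : SNode ℕ) ∈ exNodes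
    decide +kernel
  · refine ⟨by decide, by decide, by decide, by decide, by decide, by decide, ?_, ?_, ?_⟩
    · show _ ∈ exNodes
      decide +kernel
    · show _ ∈ exNodes
      decide +kernel
    · unfold CompatibleChild cladeUnion
      decide +kernel

end Phylo
end

section
/- Let τ be a rooted bifurcating topology on a taxon set X and let D be its sDAG representation. Then D contains exactly one topology, namely τ itself. -/
namespace Phylo

theorem subset_cladeUnion {α : Type*} [DecidableEq α] {t : SNode α} {A : Finset α}
    (h : A ∈ t) : A ⊆ cladeUnion t :=
  Finset.le_sup (f := id) h

/-- In an sDAG a leaf node has no outgoing edge. -/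
theorem not_leaf_of_edge {α : Type*} [DecidableEq α] {X : Finset α} {D : Digraph α}
    (hD : IsSDag X D) {t s : SNode α} (h : (t, s) ∈ D.edges) : ¬ IsLeafNode t := by
  rintro ⟨x, rfl⟩
  obtain ⟨-, hs, hu, hne⟩ := hD.2.2.2 _ h
  obtain ⟨-, hn, -, hc, -⟩ := hD.2.2.1 _ hs
  simp only at hn hc hu hne
  apply hne
  rw [Finset.mem_singleton] at hu
  have key : ∀ A ∈ s, A = {x} := by
    intro A hA
    have h1 := subset_cladeUnion hA
    rw [hu] at h1
    exact (Finset.Nonempty.subset_singleton_iff (hn A hA)).1 h1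
  have hne' : s.Nonempty := by
    rw [← Finset.card_pos]; omega
  exact Finset.eq_singleton_iff_nonempty_unique_mem.2 ⟨hne', key⟩

/-- Along an edge not starting in the root, the clade union strictly shrinks. -/
theorem card_lt_of_edge {α : Type*} [DecidableEq α] {X : Finset α} {D : Digraph α}
    (hD : IsSDag X D) {t s : SNode α} (h : (t, s) ∈ D.edges) (ht : t ≠ {X}) :
    (cladeUnion s).card < (cladeUnion t).card ∧ (cladeUnion t).card ≤ X.card := by
  have hl := not_leaf_of_edge hD h
  obtain ⟨htn, -, hu, -⟩ := hD.2.2.2 _ h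
  obtain ⟨hX, hn, hd, hc, h1⟩ := hD.2.2.1 _ htn
  simp only at hX hn hd hc h1 hu
  have h2 : t.card = 2 := by
    rcases hc with hc | hc
    · rcases h1 hc with h | h
      · exact absurd h ht
      · exact absurd h hl
    · exact hc
  obtain ⟨B, hB, hBne⟩ := Finset.exists_mem_ne (by omega : 1 < t.card) (cladeUnion s)
  refine ⟨Finset.card_lt_card ?_, Finset.card_le_card (Finset.sup_le hX)⟩
  refine Finset.ssubset_iff_subset_ne.2 ⟨subset_cladeUnion hu, fun he => ?_⟩
  have h3 := subset_cladeUnion hB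
  rw [← he] at h3
  obtain ⟨y, hy⟩ := hn B hB
  exact Finset.disjoint_left.1 (hd B hB _ hu hBne) hy (h3 hy)

/-- A rooted bifurcating topology `τ` on `X`, viewed as an sDAG,
contains exactly one topology, namely `τ` itself. -/
theorem statement_16 {α : Type*} [DecidableEq α] (X : Finset α) (τ : Digraph α)
    (hτ : IsTopology X τ) :
    ∀ σ : Digraph α, IsTopologyIn X τ σ ↔ σ = τ := by
  intro σ
  constructor
  · rintro ⟨hσ, hn, he⟩
    obtain ⟨hD, hch, hpar⟩ := hτ
    obtain ⟨hD', hch', -⟩ := hσ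
    have step : ∀ t s, t ∈ σ.nodes → (t, s) ∈ τ.edges → (t, s) ∈ σ.edges := by
      intro t s ht hts
      have hl := not_leaf_of_edge hD hts
      have hu : cladeUnion s ∈ t := (hD.2.2.2 _ hts).2.2.1
      obtain ⟨s', ⟨hs', hu'⟩, -⟩ := hch' t ht hl _ hu
      have : s' = s := (hch t (hn ht) hl _ hu).unique ⟨he hs', hu'⟩ ⟨hts, rfl⟩
      exact this ▸ hs'
    have nodes : ∀ n : ℕ, ∀ s ∈ τ.nodes, X.card - (cladeUnion s).card = n → s ∈ σ.nodes := by
      intro n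
      induction n using Nat.strong_induction_on with
      | _ n ih =>
        intro s hs hsn
        by_cases hsX : s = {X}
        · rw [hsX]; exact hD'.1
        obtain ⟨t, hts, -⟩ := hpar s hs hsX
        have htσ : t ∈ σ.nodes := by
          by_cases htX : t = {X}
          · rw [htX]; exact hD'.1
          obtain ⟨h1, h2⟩ := card_lt_of_edge hD hts htX
          exact ih _ (by omega) t (hD.2.2.2 _ hts).1 rfl
        exact (hD'.2.2.2 _ (step t s htσ hts)).2.1
    have hN : σ.nodes = τ.nodes := Set.Subset.antisymm hn fun s hs => nodes _ s hs rfl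
    have hE : σ.edges = τ.edges := Set.Subset.antisymm he fun e hE =>
      step e.1 e.2 (nodes _ _ (hD.2.2.2 _ hE).1 rfl) hE
    cases σ; cases τ
    simp only at hN hE
    rw [hN, hE]
  · rintro rfl
    exact ⟨hτ, subset_rfl, subset_rfl⟩

end Phylo
end
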